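/- Let $d$ be an element of a commutative ring $R$ (e.g. an integer), and let $N, r$ be natural numbers with $r \le N$. Suppose $s_0, \dots, s_r \in R$ and $R_0, \dots, R_r \in R$ satisfy, for every $p$ with $0 \le p \le r$ and $m = N - r + p$, the Eklund–Jost–Peterson relations $\sum_{i=0}^{p} \binom{m}{p-i} d^{\,p-i} s_{r-i} = d^{\,m} - R_p$. Then for every $i$ with $0 \le i \le r$, $s_i = \sum_{j=i}^{r} \binom{N-i}{j-i} (-d)^{\,j-i} \left( d^{\,N-j} - R_{r-j} \right)$. -/

import Mathlib

theorem EJP_inner {R : Type*} [CommRing R] (d : R) (M t : ℕ) :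
    ∑ a ∈ Finset.range (t + 1),
      (M.choose a : R) * (-d) ^ a * (((M - a).choose (t - a) : R) * d ^ (t - a))
      = if t = 0 then 1 else 0 := by
  have h1 : ∀ a ∈ Finset.range (t + 1),
      (M.choose a : R) * (-d) ^ a * (((M - a).choose (t - a) : R) * d ^ (t - a))
      = (M.choose t : R) * d ^ t * (((-1) ^ a * (t.choose a : ℤ) : ℤ) : R) := by
    intro a ha
    have hat : a ≤ t := by simpa [Nat.lt_succ_iff] using ha
    have h2 : (M.choose t : R) * (t.choose a : R)
        = (M.choose a : R) * ((M - a).choose (t - a) : R) := by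
      exact_mod_cast congrArg (Nat.cast : ℕ → R) (Nat.choose_mul hat)
    have h3 : d ^ t = d ^ a * d ^ (t - a) := by
      rw [← pow_add, Nat.add_sub_cancel' hat]
    rw [h3, neg_pow]
    push_cast
    linear_combination (-(-1) ^ a * d ^ a * d ^ (t - a)) * h2
  rw [Finset.sum_congr rfl h1, ← Finset.mul_sum, ← Int.cast_sum,
    Int.alternating_sum_range_choose]
  split_ifs with h
  · simp [h]
  · simp

/-- Closed-form solution of the Eklund–Jost–Peterson relations for the
Segre class coefficients of a subscheme of projective space. -/
theorem EJP_closed_form_solution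
    (R : Type*) [CommRing R] (d : R) (N r : ℕ) (hrN : r ≤ N)
    (s Res : ℕ → R)
    (hEJP : ∀ p, p ≤ r →
      (∑ i ∈ Finset.range (p + 1),
        ((N - r + p).choose (p - i) : R) * d ^ (p - i) * s (r - i))
        = d ^ (N - r + p) - Res p) :
    ∀ i, i ≤ r →
      s i = ∑ j ∈ Finset.Icc i r,
        ((N - i).choose (j - i) : R) * (-d) ^ (j - i) * (d ^ (N - j) - Res (r - j)) := by
  intro i hi
  have key : ∀ j ∈ Finset.Ico i (r + 1), d ^ (N - j) - Res (r - j)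
      = ∑ k ∈ Finset.Ico j (r + 1), ((N - j).choose (k - j) : R) * d ^ (k - j) * s k := by
    intro j hj
    have hjr : j ≤ r := by
      have := (Finset.mem_Ico.mp hj).2
      omega
    have h := hEJP (r - j) (Nat.sub_le _ _)
    have e : N - r + (r - j) = N - j := by omega
    rw [e] at h
    rw [← h, Finset.sum_Ico_eq_sum_range, ← Finset.sum_range_reflect]
    have e2 : r + 1 - j = r - j + 1 := by omega
    rw [e2]
    refine Finset.sum_congr rfl fun x hx => ?_
    have hx' := Finset.mem_range.mp hx
    have e3 : r - j - (r - j + 1 - 1 - x) = j + x - j := by omega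
    have e4 : r - (r - j + 1 - 1 - x) = j + x := by omega
    rw [e3, e4]
  have hI : Finset.Icc i r = Finset.Ico i (r + 1) := by
    ext x
    simp only [Finset.mem_Icc, Finset.mem_Ico]
    omega
  rw [hI, Finset.sum_congr rfl fun j hj => by rw [key j hj, Finset.mul_sum],
    Finset.sum_Ico_Ico_comm]
  have h5 : ∀ k ∈ Finset.Ico i (r + 1),
      ∑ j ∈ Finset.Ico i (k + 1), ((N - i).choose (j - i) : R) * (-d) ^ (j - i) *
        (((N - j).choose (k - j) : R) * d ^ (k - j) * s k)
      = if k = i then s k else 0 := by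
    intro k hk
    have hk' := Finset.mem_Ico.mp hk
    have e := EJP_inner d (N - i) (k - i)
    have e2 : k + 1 - i = k - i + 1 := by omega
    rw [Finset.sum_Ico_eq_sum_range, e2]
    have e3 : (if k = i then s k else 0) = (if k - i = 0 then (1 : R) else 0) * s k := by
      have : k - i = 0 ↔ k = i := by omega
      simp [this]
    rw [e3, ← e, Finset.sum_mul]
    refine Finset.sum_congr rfl fun x _ => ?_
    rw [Nat.add_sub_cancel_left, Nat.sub_add_eq, Nat.sub_add_eq]
    ring
  rw [Finset.sum_congr rfl h5, Finset.sum_ite_eq' , if_pos]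
  exact Finset.mem_Ico.mpr ⟨le_rfl, by omega⟩
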